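/- Let d ≥ 1 and z ∈ (0,1). Suppose D: ℤ^d → [0,1] is a ℤ^d-symmetric probability distribution, not supported on a proper sublattice of ℤ^d, with ∑_x ‖x‖₂² D(x) < ∞. Then the limit m̃_z = lim_{n→∞} (−log S_z(n e₁))/n exists in [0,∞); it coincides with m_z = sup{t ≥ 0 : ∑_{x∈ℤ^d} S_z(x)e^{t x₁} < ∞}; and m̃_z → 0 as z → 1⁻. -/

import Mathlib

open scoped BigOperators ENNReal Real Topology Pointwise
open MeasureTheory Matrix Filter

noncomputable section

namespace OZpaper

variable {d : ℕ}

/-- Dot product of a real vector with a lattice point. -/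
def rdotZ (μ : Fin d → ℝ) (x : Fin d → ℤ) : ℝ := ∑ i, μ i * (x i : ℝ)

/-- Dot product of two real vectors. -/
def rdot (μ x : Fin d → ℝ) : ℝ := ∑ i, μ i * x i

/-- Euclidean norm of a lattice point. -/
def enormZ (x : Fin d → ℤ) : ℝ := Real.sqrt (∑ i, ((x i : ℝ)) ^ 2)

/-- Euclidean norm of a real vector. -/
def enormR (x : Fin d → ℝ) : ℝ := Real.sqrt (∑ i, (x i) ^ 2)

/-- ℓ¹ norm of a real vector. -/
def l1R (x : Fin d → ℝ) : ℝ := ∑ i, |x i|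

/-- ℓ∞ norm of a real vector. -/
def linftyR (x : Fin d → ℝ) : ℝ := ⨆ i, |x i|

/-- The vector `t • e₁`. -/
def e1R (d : ℕ) (t : ℝ) : Fin d → ℝ := fun i => if (i : ℕ) = 0 then t else 0

/-- The lattice point `n • e₁`. -/
def e1Z (d : ℕ) (n : ℤ) : Fin d → ℤ := fun i => if (i : ℕ) = 0 then n else 0

/-- Cast of a lattice point to a real vector. -/
def toR (x : Fin d → ℤ) : Fin d → ℝ := fun i => (x i : ℝ)

/-- ℤ^d-symmetry: invariance under coordinate permutations and sign flips. -/
def ZdSymmetric (f : (Fin d → ℤ) → ℝ) : Prop :=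
  (∀ (σ : Equiv.Perm (Fin d)) (x : Fin d → ℤ), f (fun i => x (σ i)) = f x) ∧
  (∀ (ε : Fin d → Bool) (x : Fin d → ℤ), f (fun i => if ε i then -(x i) else x i) = f x)

/-- Tilted susceptibility `χ^{(μ)}`, valued in `ℝ≥0∞`. -/
def chi (S : (Fin d → ℤ) → ℝ) (μ : Fin d → ℝ) : ℝ≥0∞ :=
  ∑' x, ENNReal.ofReal (S x * Real.exp (rdotZ μ x))

/-- The set `Ω = {μ : χ^{(μ)} < ∞}`. -/
def Omega (S : (Fin d → ℤ) → ℝ) : Set (Fin d → ℝ) := {μ | chi S μ < ⊤}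

/-- The mass `m_S`. -/
def mass (S : (Fin d → ℤ) → ℝ) : ℝ := sSup {t : ℝ | 0 ≤ t ∧ chi S (e1R d t) < ⊤}

/-- Assumption Ω. -/
structure AssumptionOmega (S : (Fin d → ℤ) → ℝ) : Prop where
  nonneg : ∀ x, 0 ≤ S x
  symm : ZdSymmetric S
  open_Omega : IsOpen (Omega S)
  zero_mem : (0 : Fin d → ℝ) ∈ Omega S
  exists_not_mem : ∃ μ₁ : ℝ, 0 < μ₁ ∧ e1R d μ₁ ∉ Omega S

/-- Fourier transform `Q̂(k) = ∑_y Q(y) e^{-i k·y}`. -/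
def fourierZ (Q : (Fin d → ℤ) → ℝ) (k : Fin d → ℝ) : ℂ :=
  ∑' y, (Q y : ℂ) * Complex.exp (-Complex.I * (rdotZ k y : ℂ))

/-- ℓ^p norm of a function on ℤ^d, valued in `ℝ≥0∞`. -/
def lpNorm (f : (Fin d → ℤ) → ℝ) (p : ℝ) : ℝ≥0∞ :=
  (∑' y, ENNReal.ofReal (|f y| ^ p)) ^ (1 / p)

/-- The exponent `p_d`. -/
def pExp (d : ℕ) (ζ : ℝ) : ℝ := if d = 1 then 2 else (d : ℝ) / ((d : ℝ) - 2 + min ζ 2)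

/-- The class 𝒬_{M,K,ζ} without the (d-1)-th moment bounds. -/
structure MemQweak (M K ζ : ℝ) (Q g : (Fin d → ℤ) → ℝ) : Prop where
  Q_l1 : lpNorm Q 1 ≤ ENNReal.ofReal M
  Q_moment : lpNorm (fun y => enormZ y ^ (2 + ζ) * Q y) 1 ≤ ENNReal.ofReal M
  infrared : ∀ k : Fin d → ℝ, (∀ i, |k i| ≤ π) →
    K * enormR k ^ 2 ≤ (fourierZ Q 0 - fourierZ Q k).re
  g_l1 : lpNorm g 1 ≤ ENNReal.ofReal M
  g_zeta : lpNorm (fun y => enormZ y ^ ζ * g y) 1 ≤ ENNReal.ofReal M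
  g_two : lpNorm (fun y => enormZ y ^ (2 : ℝ) * g y) (min (pExp d ζ) 2) ≤ ENNReal.ofReal M

/-- The class 𝒬_{M,K,ζ}. -/
structure MemQ (M K ζ : ℝ) (Q g : (Fin d → ℤ) → ℝ) : Prop where
  Q_l1 : lpNorm Q 1 ≤ ENNReal.ofReal M
  Q_moment : lpNorm (fun y => enormZ y ^ (2 + ζ) * Q y) 1 ≤ ENNReal.ofReal M
  infrared : ∀ k : Fin d → ℝ, (∀ i, |k i| ≤ π) →
    K * enormR k ^ 2 ≤ (fourierZ Q 0 - fourierZ Q k).re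
  g_l1 : lpNorm g 1 ≤ ENNReal.ofReal M
  g_zeta : lpNorm (fun y => enormZ y ^ ζ * g y) 1 ≤ ENNReal.ofReal M
  g_two : lpNorm (fun y => enormZ y ^ (2 : ℝ) * g y) (min (pExp d ζ) 2) ≤ ENNReal.ofReal M
  Q_dm1 : 4 ≤ d →
    lpNorm (fun y => enormZ y ^ ((d : ℝ) - 1) * Q y) (min ((d : ℝ) / 3) 2) ≤ ENNReal.ofReal M
  g_dm1 : 4 ≤ d →
    lpNorm (fun y => enormZ y ^ ((d : ℝ) - 1) * g y) 2 ≤ ENNReal.ofReal M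

/-- Convolution on ℤ^d. -/
def conv (f g : (Fin d → ℤ) → ℝ) (x : Fin d → ℤ) : ℝ := ∑' y, f (x - y) * g y

/-- Exponential tilt `f^{(μ)}`. -/
def tilt (f : (Fin d → ℤ) → ℝ) (μ : Fin d → ℝ) : (Fin d → ℤ) → ℝ :=
  fun x => f x * Real.exp (rdotZ μ x)

/-- `∑_y f(y) e^{μ·y}`, i.e. `f̂^{(μ)}(0)`. -/
def tiltSum (f : (Fin d → ℤ) → ℝ) (μ : Fin d → ℝ) : ℝ := ∑' y, f y * Real.exp (rdotZ μ y)

/-- Assumption J. -/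
structure AssumptionJ (S J h : (Fin d → ℤ) → ℝ) (M K ζ : ℝ) : Prop where
  M_pos : 0 < M
  K_pos : 0 < K
  zeta_pos : 0 < ζ
  J_symm : ZdSymmetric J
  h_symm : ZdSymmetric h
  J_summable : Summable fun x => |J x|
  h_summable : Summable fun x => |h x|
  OZ_eq : ∀ x, S x = h x + conv J S x
  memQ : ∀ μ ∈ closure (Omega S), MemQ M K ζ (tilt J μ) (tilt h μ)
  hhat_pos : ∀ μ ∈ closure (Omega S), 0 < tiltSum h μ

/-- Assumption J, without the (d-1)-th moment bounds of the class 𝒬. -/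
structure AssumptionJweak (S J h : (Fin d → ℤ) → ℝ) (M K ζ : ℝ) : Prop where
  M_pos : 0 < M
  K_pos : 0 < K
  zeta_pos : 0 < ζ
  J_symm : ZdSymmetric J
  h_symm : ZdSymmetric h
  J_summable : Summable fun x => |J x|
  h_summable : Summable fun x => |h x|
  OZ_eq : ∀ x, S x = h x + conv J S x
  memQ : ∀ μ ∈ closure (Omega S), MemQweak M K ζ (tilt J μ) (tilt h μ)
  hhat_pos : ∀ μ ∈ closure (Omega S), 0 < tiltSum h μ

/-- `μ` is the optimal tilt `μ_x̂` for direction `x`. -/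
def IsOptTilt (S : (Fin d → ℤ) → ℝ) (x μ : Fin d → ℝ) : Prop :=
  μ ∈ frontier (Omega S) ∧ ∀ ν ∈ closure (Omega S), rdot ν x ≤ rdot μ x

/-- The norm `|x|_S = (max_{μ ∈ Ω̄} μ·x)/m_S`. -/
def normS (S : (Fin d → ℤ) → ℝ) (x : Fin d → ℝ) : ℝ :=
  sSup ((fun μ => rdot μ x) '' closure (Omega S)) / mass S

/-- The drift vector `η` of the tilted kernel. -/
def etaOf (J : (Fin d → ℤ) → ℝ) (μ : Fin d → ℝ) : Fin d → ℝ :=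
  fun j => ∑' y, (y j : ℝ) * J y * Real.exp (rdotZ μ y)

/-- The covariance matrix `Λ` of the tilted kernel. -/
def LambdaOf (J : (Fin d → ℤ) → ℝ) (μ : Fin d → ℝ) : Matrix (Fin d) (Fin d) ℝ :=
  Matrix.of fun j l => ∑' y, (y j : ℝ) * (y l : ℝ) * J y * Real.exp (rdotZ μ y)

/-- The Brownian heat kernel `ρ_t(x; η, Λ)`. -/
def heatKer (d : ℕ) (t : ℝ) (x η : Fin d → ℝ) (Λ : Matrix (Fin d) (Fin d) ℝ) : ℝ :=
  (1 / Real.sqrt Λ.det) * (1 / (2 * π * t) ^ ((d : ℝ) / 2)) *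
    Real.exp (-(1 / (2 * t)) * rdot (x - t • η) (Λ⁻¹ *ᵥ (x - t • η)))

/-- The Brownian Green function `𝒞(x; η, Λ)`. -/
def greenC (d : ℕ) (x η : Fin d → ℝ) (Λ : Matrix (Fin d) (Fin d) ℝ) : ℝ :=
  ∫ t in Set.Ioi (0 : ℝ), heatKer d t x η Λ

/-- The massive continuum Green function `𝔾_a(x)`. -/
def massiveG (d : ℕ) (a : ℝ) (x : Fin d → ℝ) : ℝ :=
  ∫ t in Set.Ioi (0 : ℝ),
    (1 / (2 * π * t) ^ ((d : ℝ) / 2)) * Real.exp (-enormR x ^ 2 / (2 * t)) *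
      Real.exp (-(t * a ^ 2) / 2)

/-- The constant `A_φ = ∫_{ℝ^d} ‖y‖₂^φ 𝔾₁(y) dy`. -/
def Aconst (d : ℕ) (φ : ℝ) : ℝ := ∫ y : Fin d → ℝ, enormR y ^ φ * massiveG d 1 y

/-- The torus `[-π, π]^d`. -/
def torus (d : ℕ) : Set (Fin d → ℝ) := Set.univ.pi fun _ => Set.Icc (-π) π

/-- The Fourier integral `I_t(x)`. -/
def It (Q g : (Fin d → ℤ) → ℝ) (t : ℝ) (x : Fin d → ℤ) : ℂ :=
  (((2 * π) ^ d : ℝ) : ℂ)⁻¹ *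
    ∫ k in torus d, Complex.exp (Complex.I * (rdotZ k x : ℂ)) * fourierZ g k *
      Complex.exp (-(t : ℂ) * (fourierZ Q 0 - fourierZ Q k))

/-- The quantity `G_Q(x)`. -/
def GQ (Q g : (Fin d → ℤ) → ℝ) (x : Fin d → ℤ) : ℂ :=
  ∫ t in Set.Ioi (0 : ℝ), It Q g t x

/-- The Kronecker delta at the origin. -/
def deltaZ (d : ℕ) : (Fin d → ℤ) → ℝ := fun x => if x = 0 then 1 else 0

/-- n-fold convolution power. -/
def convPow (D : (Fin d → ℤ) → ℝ) : ℕ → (Fin d → ℤ) → ℝ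
  | 0 => deltaZ d
  | n + 1 => conv D (convPow D n)

/-- Random-walk Green function `S_z(x) = ∑_n z^n D^{*n}(x)`. -/
def rwG (D : (Fin d → ℤ) → ℝ) (z : ℝ) (x : Fin d → ℤ) : ℝ :=
  ∑' n : ℕ, z ^ n * convPow D n x

/-- `σ² = ∑_x ‖x‖₂² J(x)`. -/
def sigmaSq (J : (Fin d → ℤ) → ℝ) : ℝ := ∑' x, enormZ x ^ 2 * J x

/-- Susceptibility `χ = ∑_x S(x)`. -/
def suscept (S : (Fin d → ℤ) → ℝ) : ℝ := ∑' x, S x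

/-- `ĥ(0) = ∑_x h(x)`. -/
def h0 (h : (Fin d → ℤ) → ℝ) : ℝ := ∑' x, h x

/-- Correlation length of order φ. -/
def xiPhi (S : (Fin d → ℤ) → ℝ) (φ : ℝ) : ℝ :=
  ((∑' x, enormZ x ^ φ * S x) / suscept S) ^ (1 / φ)

/-- A critical family of OZ systems. -/
structure CriticalFamily (d : ℕ) (δ zc M K ζ : ℝ) (S J h : ℝ → (Fin d → ℤ) → ℝ) : Prop where
  δ_pos : 0 < δ
  assumOmega : ∀ z ∈ Set.Ico (zc - δ) zc, AssumptionOmega (S z)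
  assumJ : ∀ z ∈ Set.Ico (zc - δ) zc, AssumptionJ (S z) (J z) (h z) M K ζ
  mass_tendsto : Tendsto (fun z => mass (S z)) (𝓝[<] zc) (𝓝 0)

/-- Convolution on ℤ. -/
def convZ (f g : ℤ → ℝ) (x : ℤ) : ℝ := ∑' y, f (x - y) * g y

/-- n-fold convolution power on ℤ. -/
def convZPow (f : ℤ → ℝ) : ℕ → ℤ → ℝ
  | 0 => fun x => if x = 0 then 1 else 0
  | n + 1 => convZ f (convZPow f n)

theorem hasSum_comp_sub_left {D : (Fin d → ℤ) → ℝ} (hD : HasSum D 1) (x : Fin d → ℤ) :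
    HasSum (fun y => D (x - y)) 1 :=
  (Equiv.subLeft x).hasSum_iff.mpr hD

theorem summable_conv {D f : (Fin d → ℤ) → ℝ} (h0 : ∀ x, 0 ≤ D x) (hD : HasSum D 1) {C : ℝ}
    (hf : ∀ y, |f y| ≤ C) (x : Fin d → ℤ) : Summable fun y => D (x - y) * f y := by
  refine Summable.of_norm_bounded ((hasSum_comp_sub_left hD x).summable.mul_right C) fun y => ?_
  rw [Real.norm_eq_abs, abs_mul, abs_of_nonneg (h0 _)]
  exact mul_le_mul_of_nonneg_left (hf y) (h0 _)

theorem convPow_nonneg {D : (Fin d → ℤ) → ℝ} (h0 : ∀ x, 0 ≤ D x) (n : ℕ) (x : Fin d → ℤ) :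
    0 ≤ convPow D n x := by
  induction n generalizing x with
  | zero => simp only [convPow, deltaZ]; split_ifs <;> norm_num
  | succ n ih => exact tsum_nonneg fun y => mul_nonneg (h0 _) (ih y)

theorem convPow_le_one {D : (Fin d → ℤ) → ℝ} (h0 : ∀ x, 0 ≤ D x) (hD : HasSum D 1) (n : ℕ)
    (x : Fin d → ℤ) : convPow D n x ≤ 1 := by
  induction n generalizing x with
  | zero => simp only [convPow, deltaZ]; split_ifs <;> norm_num
  | succ n ih =>
    have hb : ∀ y, |convPow D n y| ≤ 1 := fun y => by
      rw [abs_of_nonneg (convPow_nonneg h0 n y)]; exact ih y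
    rw [← (hasSum_comp_sub_left hD x).tsum_eq]
    exact (summable_conv h0 hD hb x).tsum_le_tsum
      (fun y => mul_le_of_le_one_right (h0 _) (ih y)) (hasSum_comp_sub_left hD x).summable

theorem convPow_map {D : (Fin d → ℤ) → ℝ} (g : (Fin d → ℤ) ≃+ (Fin d → ℤ))
    (hg : ∀ x, D (g x) = D x) (n : ℕ) (x : Fin d → ℤ) : convPow D n (g x) = convPow D n x := by
  induction n generalizing x with
  | zero => simp [convPow, deltaZ]
  | succ n ih =>
    simp only [convPow, OZpaper.conv]
    rw [← g.toEquiv.tsum_eq]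
    refine tsum_congr fun y => ?_
    have h : D (g x - g y) = D (x - y) := by rw [← map_sub, hg]
    simp [h, ih]

/-- Sign flips of the coordinates, as an additive automorphism. -/
def signFlip (ε : Fin d → Bool) : (Fin d → ℤ) ≃+ (Fin d → ℤ) where
  toFun x i := if ε i then -(x i) else x i
  invFun x i := if ε i then -(x i) else x i
  left_inv x := by ext i; by_cases h : ε i <;> simp [h]
  right_inv x := by ext i; by_cases h : ε i <;> simp [h]
  map_add' x y := by ext i; by_cases h : ε i <;> simp [h, add_comm]

theorem ZdSymmetric.rwG {D : (Fin d → ℤ) → ℝ} (hD : ZdSymmetric D) (z : ℝ) :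
    ZdSymmetric (rwG D z) := by
  refine ⟨fun σ x => tsum_congr fun n => ?_, fun ε x => tsum_congr fun n => ?_⟩
  · exact congrArg _ (convPow_map (LinearEquiv.funCongrLeft ℤ ℤ σ).toAddEquiv (hD.1 σ) n x)
  · exact congrArg _ (convPow_map (signFlip ε) (hD.2 ε) n x)

theorem ZdSymmetric.map_neg {f : (Fin d → ℤ) → ℝ} (hf : ZdSymmetric f) (x : Fin d → ℤ) :
    f (-x) = f x := by
  exact hf.2 (fun _ => true) x

theorem summable_rwG {D : (Fin d → ℤ) → ℝ} (h0 : ∀ x, 0 ≤ D x) (hD : HasSum D 1) {z : ℝ}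
    (hz : z ∈ Set.Ioo (0 : ℝ) 1) (x : Fin d → ℤ) : Summable fun n => z ^ n * convPow D n x :=
  (summable_geometric_of_lt_one hz.1.le hz.2).of_nonneg_of_le
    (fun n => mul_nonneg (pow_nonneg hz.1.le n) (convPow_nonneg h0 n x))
    (fun n => mul_le_of_le_one_right (pow_nonneg hz.1.le n) (convPow_le_one h0 hD n x))

theorem rwG_nonneg {D : (Fin d → ℤ) → ℝ} (h0 : ∀ x, 0 ≤ D x) {z : ℝ}
    (hz : z ∈ Set.Ioo (0 : ℝ) 1) (x : Fin d → ℤ) : 0 ≤ rwG D z x :=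
  tsum_nonneg fun n => mul_nonneg (pow_nonneg hz.1.le n) (convPow_nonneg h0 n x)

theorem abs_rwG_le {D : (Fin d → ℤ) → ℝ} (h0 : ∀ x, 0 ≤ D x) (hD : HasSum D 1) {z : ℝ}
    (hz : z ∈ Set.Ioo (0 : ℝ) 1) (x : Fin d → ℤ) : |rwG D z x| ≤ (1 - z)⁻¹ := by
  rw [abs_of_nonneg (rwG_nonneg h0 hz x), ← tsum_geometric_of_lt_one hz.1.le hz.2]
  exact (summable_rwG h0 hD hz x).tsum_le_tsum
    (fun n => mul_le_of_le_one_right (pow_nonneg hz.1.le n) (convPow_le_one h0 hD n x))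
    (summable_geometric_of_lt_one hz.1.le hz.2)

/-- The Green function equation `S = δ₀ + z D * S`. -/
theorem rwG_eq {D : (Fin d → ℤ) → ℝ} (h0 : ∀ x, 0 ≤ D x) (hD : HasSum D 1) {z : ℝ}
    (hz : z ∈ Set.Ioo (0 : ℝ) 1) (x : Fin d → ℤ) :
    rwG D z x = deltaZ d x + z * OZpaper.conv D (rwG D z) x := by
  have hsum : Summable (Function.uncurry fun (n : ℕ) (y : Fin d → ℤ) =>
      z ^ n * (D (x - y) * convPow D n y)) := by
    refine ((summable_geometric_of_lt_one hz.1.le hz.2).mul_of_nonneg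
      (hasSum_comp_sub_left hD x).summable (fun n => pow_nonneg hz.1.le n)
      (fun y => h0 _)).of_nonneg_of_le ?_ ?_
    · exact fun p => mul_nonneg (pow_nonneg hz.1.le _) (mul_nonneg (h0 _) (convPow_nonneg h0 _ _))
    · exact fun p => mul_le_mul_of_nonneg_left
        (mul_le_of_le_one_right (h0 _) (convPow_le_one h0 hD _ _)) (pow_nonneg hz.1.le _)
  have hcomm := hsum.tsum_comm
  rw [rwG, (summable_rwG h0 hD hz x).tsum_eq_zero_add]
  congr 1
  · simp [convPow]
  · simp only [convPow, OZpaper.conv, rwG, pow_succ']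
    simp only [mul_assoc]
    rw [tsum_mul_left]
    congr 1
    simp only [← tsum_mul_left]
    rw [← hcomm]
    exact tsum_congr fun y => tsum_congr fun n => by ring

/-- Minimum principle for `z D *` off the origin. -/
theorem nonneg_of_superharmonic {D u : (Fin d → ℤ) → ℝ} (h0 : ∀ x, 0 ≤ D x) (hD : HasSum D 1)
    {z C : ℝ} (hz : z ∈ Set.Ioo (0 : ℝ) 1) (hC : ∀ x, |u x| ≤ C) (hu0 : 0 ≤ u 0)
    (hu : ∀ x ≠ 0, z * OZpaper.conv D u x ≤ u x) (x : Fin d → ℤ) : 0 ≤ u x := by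
  have hbdd : BddBelow (Set.range u) := ⟨-C, by rintro _ ⟨y, rfl⟩; exact (abs_le.mp (hC y)).1⟩
  set m := ⨅ y, u y with hm
  have hmu : ∀ y, m ≤ u y := fun y => ciInf_le hbdd y
  refine le_trans ?_ (hmu x)
  by_contra! hneg
  have hzm : z * m ≤ m := by
    refine le_ciInf fun y => ?_
    by_cases hy : y = 0
    · rw [hy]; exact (mul_nonpos_of_nonneg_of_nonpos hz.1.le hneg.le).trans hu0
    · refine le_trans (mul_le_mul_of_nonneg_left ?_ hz.1.le) (hu y hy)
      have hs := (hasSum_comp_sub_left hD y).mul_right m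
      rw [one_mul] at hs
      rw [← hs.tsum_eq]
      exact hs.summable.tsum_le_tsum (fun w => mul_le_mul_of_nonneg_left (hmu w) (h0 _))
        (summable_conv h0 hD hC y)
  nlinarith [hz.2]

theorem rwG_mul_le {D : (Fin d → ℤ) → ℝ} (h0 : ∀ x, 0 ≤ D x) (hD : HasSum D 1)
    {z : ℝ} (hz : z ∈ Set.Ioo (0 : ℝ) 1) (x y : Fin d → ℤ) :
    rwG D z x * rwG D z y ≤ rwG D z 0 * rwG D z (x + y) := by
  set S := rwG D z with hS
  have hS0 : ∀ w, 0 ≤ S w := rwG_nonneg h0 hz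
  have hSC : ∀ w, |S w| ≤ (1 - z)⁻¹ := abs_rwG_le h0 hD hz
  suffices h : ∀ x, 0 ≤ S 0 * S (x + y) - S y * S x by linarith [h x, mul_comm (S x) (S y)]
  have hCnn : 0 ≤ (1 - z)⁻¹ := (abs_nonneg _).trans (hSC 0)
  refine nonneg_of_superharmonic h0 hD hz
    (C := (1 - z)⁻¹ * (1 - z)⁻¹ + (1 - z)⁻¹ * (1 - z)⁻¹) (fun w => ?_) ?_ fun w hw => ?_
  · refine (abs_sub _ _).trans ?_
    rw [abs_mul, abs_mul]
    gcongr <;> apply hSC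
  · simp [mul_comm]
  · have h1 : z * OZpaper.conv D S w = S w := by
      rw [hS, rwG_eq h0 hD hz w]; simp [deltaZ, hw]
    have h2 : z * OZpaper.conv D S (w + y) ≤ S (w + y) := by
      rw [hS, rwG_eq h0 hD hz (w + y)]
      have : 0 ≤ deltaZ d (w + y) := by unfold deltaZ; split_ifs <;> norm_num
      linarith
    have h3 : OZpaper.conv D (fun w => S 0 * S (w + y) - S y * S w) w =
        S 0 * OZpaper.conv D S (w + y) - S y * OZpaper.conv D S w := by
      have h4 : OZpaper.conv D S (w + y) = ∑' v, D (w - v) * S (v + y) := by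
        rw [OZpaper.conv, ← (Equiv.addRight y).tsum_eq]
        simp
      rw [h4]
      simp only [OZpaper.conv]
      rw [← tsum_mul_left, ← tsum_mul_left, ← Summable.tsum_sub]
      · exact tsum_congr fun v => by ring
      · exact (summable_conv h0 hD (f := fun v => S (v + y)) (fun v => hSC _) w).mul_left _
      · exact (summable_conv h0 hD hSC w).mul_left _
    rw [h3]
    have h5 := mul_le_mul_of_nonneg_left h2 (hS0 0)
    linear_combination h5 - S y * h1

theorem rwG_zero_pos {D : (Fin d → ℤ) → ℝ} (h0 : ∀ x, 0 ≤ D x) (hD : HasSum D 1)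
    {z : ℝ} (hz : z ∈ Set.Ioo (0 : ℝ) 1) : 0 < rwG D z 0 := by
  rw [rwG_eq h0 hD hz]
  have : 0 ≤ OZpaper.conv D (rwG D z) 0 :=
    tsum_nonneg fun y => mul_nonneg (h0 _) (rwG_nonneg h0 hz y)
  have := mul_nonneg hz.1.le this
  simp only [deltaZ, if_true]
  linarith

theorem rwG_pos {D : (Fin d → ℤ) → ℝ} (h0 : ∀ x, 0 ≤ D x) (hD : HasSum D 1)
    (hsym : ZdSymmetric D)
    (hsupp : ∀ L : AddSubgroup (Fin d → ℤ), (∀ x, D x ≠ 0 → x ∈ L) → L = ⊤)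
    {z : ℝ} (hz : z ∈ Set.Ioo (0 : ℝ) 1) (x : Fin d → ℤ) : 0 < rwG D z x := by
  have hpos := rwG_zero_pos h0 hD hz
  let L : AddSubgroup (Fin d → ℤ) :=
    { carrier := {x | 0 < rwG D z x}
      add_mem' := fun {a b} ha hb =>
        pos_of_mul_pos_right ((mul_pos ha hb).trans_le (rwG_mul_le h0 hD hz a b)) hpos.le
      zero_mem' := hpos
      neg_mem' := fun {a} ha => by
        simpa only [Set.mem_ofPred_eq, (hsym.rwG z).map_neg a] using ha }
  have hL : L = ⊤ := by
    refine hsupp L fun y hy => ?_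
    change 0 < rwG D z y
    rw [rwG_eq h0 hD hz]
    have hdel : 0 ≤ deltaZ d y := by unfold deltaZ; split_ifs <;> norm_num
    have hle : D y * rwG D z 0 ≤ OZpaper.conv D (rwG D z) y := by
      have := (summable_conv h0 hD (abs_rwG_le h0 hD hz) y).le_tsum 0
        fun w _ => mul_nonneg (h0 _) (rwG_nonneg h0 hz w)
      simpa only [OZpaper.conv, sub_zero] using this
    have := mul_pos hz.1 ((mul_pos ((h0 y).lt_of_ne' hy) hpos).trans_le hle)
    linarith
  have : x ∈ L := hL ▸ AddSubgroup.mem_top x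
  exact this

theorem rdotZ_e1R (hd : 0 < d) (t : ℝ) (x : Fin d → ℤ) :
    rdotZ (e1R d t) x = t * (x ⟨0, hd⟩ : ℝ) := by
  rw [rdotZ, Finset.sum_eq_single ⟨0, hd⟩]
  · simp [e1R]
  · intro i _ hi
    have : (i : ℕ) ≠ 0 := fun h => hi (Fin.ext h)
    simp [e1R, this]
  · simp

theorem rdotZ_sub_add (μ : Fin d → ℝ) (x y : Fin d → ℤ) :
    rdotZ μ (x - y) + rdotZ μ y = rdotZ μ x := by
  simp only [rdotZ, ← Finset.sum_add_distrib]
  exact Finset.sum_congr rfl fun i _ => by simp; ring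

theorem chi_rwG {D : (Fin d → ℤ) → ℝ} (h0 : ∀ x, 0 ≤ D x) (hD : HasSum D 1)
    {z : ℝ} (hz : z ∈ Set.Ioo (0 : ℝ) 1) (μ : Fin d → ℝ) :
    chi (rwG D z) μ = 1 + ENNReal.ofReal z * chi D μ * chi (rwG D z) μ := by
  have key : ∀ x, ENNReal.ofReal (rwG D z x * Real.exp (rdotZ μ x)) =
      ENNReal.ofReal (deltaZ d x) + ENNReal.ofReal z * ∑' y,
        ENNReal.ofReal (D (x - y) * Real.exp (rdotZ μ (x - y))) *
          ENNReal.ofReal (rwG D z y * Real.exp (rdotZ μ y)) := by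
    intro x
    have hterm : ∀ y, 0 ≤ D (x - y) * rwG D z y * Real.exp (rdotZ μ x) := fun y =>
      mul_nonneg (mul_nonneg (h0 _) (rwG_nonneg h0 hz y)) (Real.exp_pos _).le
    have h1 : ∑' y, ENNReal.ofReal (D (x - y) * Real.exp (rdotZ μ (x - y))) *
          ENNReal.ofReal (rwG D z y * Real.exp (rdotZ μ y)) =
        ENNReal.ofReal (OZpaper.conv D (rwG D z) x * Real.exp (rdotZ μ x)) := by
      rw [OZpaper.conv, ← tsum_mul_right, ENNReal.ofReal_tsum_of_nonneg hterm
        ((summable_conv h0 hD (abs_rwG_le h0 hD hz) x).mul_right _)]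
      refine tsum_congr fun y => ?_
      rw [← ENNReal.ofReal_mul (mul_nonneg (h0 _) (Real.exp_pos _).le),
        ← rdotZ_sub_add μ x y, Real.exp_add]
      congr 1
      ring
    have hdel : deltaZ d x * Real.exp (rdotZ μ x) = deltaZ d x := by
      unfold deltaZ
      split_ifs with h
      · simp [h, rdotZ]
      · simp
    have hdel0 : 0 ≤ deltaZ d x := by unfold deltaZ; split_ifs <;> norm_num
    have hc : 0 ≤ OZpaper.conv D (rwG D z) x :=
      tsum_nonneg fun y => mul_nonneg (h0 _) (rwG_nonneg h0 hz y)
    rw [h1, ← ENNReal.ofReal_mul hz.1.le, ← ENNReal.ofReal_add hdel0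
      (mul_nonneg hz.1.le (mul_nonneg hc (Real.exp_pos _).le))]
    congr 1
    rw [rwG_eq h0 hD hz x, add_mul, hdel]
    ring
  have hdelta : ∑' x, ENNReal.ofReal (deltaZ d x) = 1 := by
    rw [tsum_eq_single 0]
    · simp [deltaZ]
    · intro x hx; simp [deltaZ, hx]
  conv_lhs => rw [chi]
  rw [tsum_congr key, ENNReal.tsum_add, hdelta, ENNReal.tsum_mul_left, ENNReal.tsum_comm, mul_assoc]
  congr 2
  simp only [ENNReal.tsum_mul_right]
  have hshift : ∀ y, ∑' x, ENNReal.ofReal (D (x - y) * Real.exp (rdotZ μ (x - y))) = chi D μ :=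
    fun y => (Equiv.subRight y).tsum_eq
      fun x => ENNReal.ofReal (D x * Real.exp (rdotZ μ x))
  simp only [hshift]
  rw [ENNReal.tsum_mul_left, chi, chi]

theorem chi_rwG_eq_top {D : (Fin d → ℤ) → ℝ} (h0 : ∀ x, 0 ≤ D x) (hD : HasSum D 1)
    {z : ℝ} (hz : z ∈ Set.Ioo (0 : ℝ) 1) {μ : Fin d → ℝ}
    (h : 1 ≤ ENNReal.ofReal z * chi D μ) : chi (rwG D z) μ = ⊤ := by
  by_contra hne
  have h1 : 1 + chi (rwG D z) μ ≤ chi (rwG D z) μ := by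
    conv_rhs => rw [chi_rwG h0 hD hz μ]
    gcongr
    simpa using mul_le_mul_left h (chi (rwG D z) μ)
  rw [add_comm] at h1
  exact absurd h1 (not_le.mpr (ENNReal.lt_add_right hne one_ne_zero))

theorem le_chi_e1R {D : (Fin d → ℤ) → ℝ} (hd : 0 < d) (h0 : ∀ x, 0 ≤ D x) (hD : HasSum D 1)
    (hsym : ZdSymmetric D) (x₀ : Fin d → ℤ) (t : ℝ) :
    ENNReal.ofReal (1 + D x₀ * (Real.cosh (t * x₀ ⟨0, hd⟩) - 1)) ≤ chi D (e1R d t) := by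
  set c := D x₀ * (Real.cosh (t * x₀ ⟨0, hd⟩) - 1) with hc
  have hflip : chi D (e1R d t) =
      ∑' x : Fin d → ℤ, ENNReal.ofReal (D x * Real.exp (-(t * x ⟨0, hd⟩))) := by
    rw [chi, ← (Equiv.neg _).tsum_eq]
    refine tsum_congr fun x => ?_
    simp [rdotZ_e1R hd, hsym.map_neg]
  have hsum : HasSum (fun x => 2 * (D x + if x = x₀ then c else 0)) (2 * (1 + c)) :=
    (hD.add (hasSum_ite_eq x₀ c)).mul_left 2
  have hcnn : 0 ≤ c := mul_nonneg (h0 _) (sub_nonneg.mpr (Real.one_le_cosh _))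
  have hnn : ∀ x, 0 ≤ 2 * (D x + if x = x₀ then c else 0) := fun x => by
    have := h0 x
    split_ifs <;> linarith
  have hdouble : 2 * ENNReal.ofReal (1 + c) ≤ 2 * chi D (e1R d t) := by
    calc 2 * ENNReal.ofReal (1 + c) = ENNReal.ofReal (2 * (1 + c)) := by
          rw [ENNReal.ofReal_mul (by norm_num)]; simp
      _ = ∑' x, ENNReal.ofReal (2 * (D x + if x = x₀ then c else 0)) := by
          rw [← hsum.tsum_eq, ENNReal.ofReal_tsum_of_nonneg hnn hsum.summable]
      _ ≤ ∑' x : Fin d → ℤ, (ENNReal.ofReal (D x * Real.exp (t * x ⟨0, hd⟩)) +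
            ENNReal.ofReal (D x * Real.exp (-(t * x ⟨0, hd⟩)))) := by
          refine ENNReal.tsum_le_tsum fun x => ?_
          rw [← ENNReal.ofReal_add (mul_nonneg (h0 _) (Real.exp_pos _).le)
            (mul_nonneg (h0 _) (Real.exp_pos _).le)]
          refine ENNReal.ofReal_le_ofReal ?_
          have hcosh : D x * Real.exp (t * x ⟨0, hd⟩) + D x * Real.exp (-(t * x ⟨0, hd⟩)) =
              2 * (D x * Real.cosh (t * x ⟨0, hd⟩)) := by rw [Real.cosh_eq]; ring
          rw [hcosh]
          by_cases h : x = x₀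
          · subst h; simp only [if_true, hc]; linarith
          · simp only [if_neg h, add_zero]
            nlinarith [mul_le_mul_of_nonneg_left (Real.one_le_cosh (t * x ⟨0, hd⟩)) (h0 x)]
      _ = 2 * chi D (e1R d t) := by
          rw [ENNReal.tsum_add, two_mul, ← hflip]
          simp only [chi, rdotZ_e1R hd]
  exact (ENNReal.mul_le_mul_iff_right (by norm_num) (by norm_num)).mp hdouble

theorem tsum_prod_pi {β : Type*} (f : β → ℝ≥0∞) (n : ℕ) :
    ∑' x : Fin n → β, ∏ i, f (x i) = (∑' b, f b) ^ n := by
  induction n with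
  | zero => simp [tsum_fintype]
  | succ n ih =>
    rw [← (Fin.consEquiv fun _ : Fin (n + 1) => β).tsum_eq, ENNReal.tsum_prod', pow_succ', ← ih,
      ← ENNReal.tsum_mul_right]
    refine tsum_congr fun b => ?_
    rw [← ENNReal.tsum_mul_left]
    refine tsum_congr fun x => ?_
    simp [Fin.consEquiv, Fin.prod_univ_succ]

theorem rwG_sq_le {D : (Fin d → ℤ) → ℝ} (h0 : ∀ x, 0 ≤ D x) (hD : HasSum D 1)
    (hd : 0 < d) (hsym : ZdSymmetric D) {z : ℝ} (hz : z ∈ Set.Ioo (0 : ℝ) 1) (x : Fin d → ℤ)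
    (j : Fin d) :
    rwG D z x ^ 2 ≤ rwG D z 0 * rwG D z (e1Z d ((2 * (x j).natAbs : ℕ) : ℤ)) := by
  have hS := hsym.rwG z
  set σ := Equiv.swap (⟨0, hd⟩ : Fin d) j
  let y : Fin d → ℤ := fun i => x (σ i)
  let ε : Fin d → Bool := fun i => decide (i ≠ ⟨0, hd⟩)
  let y' : Fin d → ℤ := fun i => if ε i then -(y i) else y i
  have hy : rwG D z y = rwG D z x := hS.1 σ x
  have hy' : rwG D z y' = rwG D z x := (hS.2 ε y).trans hy
  have hadd : y + y' = e1Z d (2 * x j) := by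
    ext i
    by_cases hi : i = ⟨0, hd⟩
    · subst hi
      simp [y, y', ε, σ, e1Z, two_mul]
    · have : (i : ℕ) ≠ 0 := fun h => hi (Fin.ext h)
      simp [y', ε, e1Z, hi, this]
  have habs : rwG D z (e1Z d (2 * x j)) = rwG D z (e1Z d ((2 * (x j).natAbs : ℕ) : ℤ)) := by
    rcases Int.natAbs_eq (x j) with h | h
    · rw [Nat.cast_mul, ← h]; rfl
    · have hneg : e1Z d ((2 * (x j).natAbs : ℕ) : ℤ) = -e1Z d (2 * x j) := by
        ext i
        simp only [e1Z, Pi.neg_apply]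
        split_ifs
        · push_cast at h ⊢; omega
        · simp
      rw [hneg, hS.map_neg]
  calc rwG D z x ^ 2 = rwG D z y * rwG D z y' := by rw [hy, hy', sq]
    _ ≤ rwG D z 0 * rwG D z (y + y') := rwG_mul_le h0 hD hz y y'
    _ = _ := by rw [hadd, habs]

theorem rwG_le_exp {D : (Fin d → ℤ) → ℝ} (h0 : ∀ x, 0 ≤ D x) (hD : HasSum D 1)
    (hd : 0 < d) (hsym : ZdSymmetric D) {z : ℝ} (hz : z ∈ Set.Ioo (0 : ℝ) 1) {l : ℝ}
    (hl : ∀ n : ℕ, rwG D z (e1Z d n) ≤ rwG D z 0 * Real.exp (-(l * n))) (x : Fin d → ℤ)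
    (j : Fin d) : rwG D z x ≤ rwG D z 0 * Real.exp (-(l * |(x j : ℝ)|)) := by
  have hS0 := rwG_nonneg h0 hz (0 : Fin d → ℤ)
  refine (sq_le_sq₀ (rwG_nonneg h0 hz x) (mul_nonneg hS0 (Real.exp_pos _).le)).mp ?_
  calc rwG D z x ^ 2 ≤ rwG D z 0 * rwG D z (e1Z d ((2 * (x j).natAbs : ℕ) : ℤ)) :=
        rwG_sq_le h0 hD hd hsym hz x j
    _ ≤ rwG D z 0 * (rwG D z 0 * Real.exp (-(l * (2 * (x j).natAbs : ℕ)))) :=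
        mul_le_mul_of_nonneg_left (hl _) hS0
    _ = (rwG D z 0 * Real.exp (-(l * |(x j : ℝ)|))) ^ 2 := by
        have : (((x j).natAbs : ℕ) : ℝ) = |(x j : ℝ)| := by
          rw [Nat.cast_natAbs, Int.cast_abs]
        rw [Nat.cast_mul, this, mul_pow, ← Real.exp_nat_mul, sq, mul_assoc]
        congr 3
        push_cast
        ring

theorem tsum_exp_neg_mul_abs_ne_top {c : ℝ} (hc : 0 < c) :
    ∑' k : ℤ, ENNReal.ofReal (Real.exp (-(c * |(k : ℝ)|))) ≠ ⊤ := by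
  have hnat : Summable fun n : ℕ => Real.exp (-(c * n)) := by
    refine (Real.summable_exp_nat_mul_of_ge (c := -c) (by linarith) (f := fun n => (n : ℝ))
      fun n => le_rfl).congr fun n => by ring_nf
  have : Summable fun k : ℤ => Real.exp (-(c * |(k : ℝ)|)) :=
    Summable.of_nat_of_neg (by simpa using hnat) (by simpa using hnat)
  rw [← ENNReal.ofReal_tsum_of_nonneg (fun k => (Real.exp_pos _).le) this]
  exact ENNReal.ofReal_ne_top

theorem chi_lt_top_of_le_exp {S : (Fin d → ℤ) → ℝ} (hd : 0 < d) {l t C : ℝ} (ht : 0 ≤ t)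
    (htl : t < l) (hS : ∀ x j, S x ≤ C * Real.exp (-(l * |(x j : ℝ)|))) (hC : 0 ≤ C) :
    chi S (e1R d t) < ⊤ := by
  have hdR : (0 : ℝ) < d := by exact_mod_cast hd
  set c := (l - t) / d with hc
  have hcpos : 0 < c := div_pos (by linarith) hdR
  have hbound : ∀ x : Fin d → ℤ, S x * Real.exp (rdotZ (e1R d t) x) ≤
      C * ∏ i, Real.exp (-(c * |(x i : ℝ)|)) := fun x => by
    have : Nonempty (Fin d) := ⟨⟨0, hd⟩⟩
    obtain ⟨j, hj⟩ := Finite.exists_max fun i => |(x i : ℝ)|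
    have hsum : ∑ i, c * |(x i : ℝ)| ≤ (l - t) * |(x j : ℝ)| := by
      calc ∑ i, c * |(x i : ℝ)| ≤ ∑ _i : Fin d, c * |(x j : ℝ)| :=
            Finset.sum_le_sum fun i _ => mul_le_mul_of_nonneg_left (hj i) hcpos.le
        _ = (l - t) * |(x j : ℝ)| := by
            rw [Finset.sum_const, Finset.card_univ, Fintype.card_fin, nsmul_eq_mul, hc]
            field_simp
    rw [← Real.exp_sum, rdotZ_e1R hd]
    refine (mul_le_mul_of_nonneg_right (hS x j) (Real.exp_pos _).le).trans ?_
    rw [mul_assoc, ← Real.exp_add, Finset.sum_neg_distrib]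
    refine mul_le_mul_of_nonneg_left (Real.exp_le_exp.mpr ?_) hC
    have := mul_le_mul_of_nonneg_left ((le_abs_self _).trans (hj ⟨0, hd⟩)) ht
    linarith
  calc chi S (e1R d t) ≤ ∑' x : Fin d → ℤ,
        ENNReal.ofReal C * ∏ i, ENNReal.ofReal (Real.exp (-(c * |(x i : ℝ)|))) := by
        refine ENNReal.tsum_le_tsum fun x => ?_
        rw [← ENNReal.ofReal_prod_of_nonneg fun i _ => (Real.exp_pos _).le,
          ← ENNReal.ofReal_mul hC]
        exact ENNReal.ofReal_le_ofReal (hbound x)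
    _ = ENNReal.ofReal C * (∑' k : ℤ, ENNReal.ofReal (Real.exp (-(c * |(k : ℝ)|)))) ^ d := by
        rw [ENNReal.tsum_mul_left,
          tsum_prod_pi fun k : ℤ => ENNReal.ofReal (Real.exp (-(c * |(k : ℝ)|)))]
    _ < ⊤ := ENNReal.mul_lt_top ENNReal.ofReal_lt_top
        (ENNReal.pow_lt_top (tsum_exp_neg_mul_abs_ne_top hcpos).lt_top)

theorem e1Z_add (m n : ℤ) : e1Z d (m + n) = e1Z d m + e1Z d n := by
  ext i
  simp only [e1Z, Pi.add_apply]
  split_ifs <;> simp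

theorem e1Z_injective (hd : 0 < d) : Function.Injective (e1Z d) := fun m n h => by
  simpa [e1Z] using congrFun h ⟨0, hd⟩

/-- A tilt above the axial decay rate makes the tilted sum infinite. -/
theorem chi_eq_top_of_tendsto {S : (Fin d → ℤ) → ℝ} (hd : 0 < d) (hpos : ∀ x, 0 < S x) {l t : ℝ}
    (hlim : Tendsto (fun n : ℕ => -Real.log (S (e1Z d n)) / n) atTop (𝓝 l)) (hlt : l < t) :
    chi S (e1R d t) = ⊤ := by
  have hev : ∀ᶠ n : ℕ in atTop,
      1 ≤ ENNReal.ofReal (S (e1Z d n) * Real.exp (rdotZ (e1R d t) (e1Z d n))) := by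
    filter_upwards [hlim.eventually (gt_mem_nhds hlt), eventually_gt_atTop 0] with n hn hn0
    have hnR : (0 : ℝ) < n := by exact_mod_cast hn0
    rw [div_lt_iff₀ hnR] at hn
    rw [ENNReal.one_le_ofReal, rdotZ_e1R hd, ← Real.exp_log (hpos (e1Z d n)), ← Real.exp_add]
    refine Real.one_le_exp ?_
    simp only [e1Z, if_true, Int.cast_natCast] at hn ⊢
    linarith
  have hinj : Function.Injective fun n : ℕ => e1Z d n :=
    (e1Z_injective hd).comp Nat.cast_injective
  by_contra hne
  have hle : ∑' n : ℕ, ENNReal.ofReal (S (e1Z d n) * Real.exp (rdotZ (e1R d t) (e1Z d n))) ≠ ⊤ :=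
    ne_top_of_le_ne_top hne (ENNReal.tsum_comp_le_tsum_of_injective hinj
      fun x => ENNReal.ofReal (S x * Real.exp (rdotZ (e1R d t) x)))
  have hzero := ENNReal.tendsto_atTop_zero_of_tsum_ne_top hle
  obtain ⟨n, h1, h2⟩ := (hev.and (hzero.eventually (gt_mem_nhds zero_lt_one))).exists
  exact absurd h2 (not_lt.mpr h1)

theorem tendsto_neg_log_rwG_div {D : (Fin d → ℤ) → ℝ} (hd : 0 < d) (h0 : ∀ x, 0 ≤ D x)
    (hD : HasSum D 1) (hsym : ZdSymmetric D)
    (hsupp : ∀ L : AddSubgroup (Fin d → ℤ), (∀ x, D x ≠ 0 → x ∈ L) → L = ⊤)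
    {z : ℝ} (hz : z ∈ Set.Ioo (0 : ℝ) 1) :
    0 ≤ mass (rwG D z) ∧
      Tendsto (fun n : ℕ => -Real.log (rwG D z (e1Z d n)) / n) atTop (𝓝 (mass (rwG D z))) := by
  set S := rwG D z with hSdef
  have hpos : ∀ x, 0 < S x := rwG_pos h0 hD hsym hsupp hz
  have hle0 : ∀ x, S x ≤ S 0 := fun x => by
    have h := rwG_mul_le h0 hD hz x (-x)
    rw [(hsym.rwG z).map_neg, add_neg_cancel] at h
    exact abs_le_of_sq_le_sq' (by simpa [sq] using h) (hpos 0).le |>.2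
  let u : ℕ → ℝ := fun n => Real.log (S 0) - Real.log (S (e1Z d n))
  have hsub : Subadditive u := fun m n => by
    have h := Real.log_le_log (mul_pos (hpos (e1Z d m)) (hpos (e1Z d n)))
      (rwG_mul_le h0 hD hz (e1Z d m) (e1Z d n))
    rw [Real.log_mul (hpos _).ne' (hpos _).ne', ← hSdef,
      Real.log_mul (hpos _).ne' (hpos _).ne', ← e1Z_add] at h
    simp only [u, Nat.cast_add]
    linarith
  have hu0 : ∀ n, 0 ≤ u n := fun n => sub_nonneg.mpr (Real.log_le_log (hpos _) (hle0 _))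
  have hbdd : BddBelow (Set.range fun n => u n / n) :=
    ⟨0, by rintro _ ⟨n, rfl⟩; exact div_nonneg (hu0 n) n.cast_nonneg⟩
  set l := hsub.lim with hl
  have hlim := hsub.tendsto_lim hbdd
  have hl0 : 0 ≤ l := ge_of_tendsto' hlim fun n => div_nonneg (hu0 n) n.cast_nonneg
  have hlim' : Tendsto (fun n : ℕ => -Real.log (S (e1Z d n)) / n) atTop (𝓝 l) := by
    have h := hlim.sub (tendsto_const_div_atTop_nhds_zero_nat (Real.log (S 0)))
    rw [sub_zero] at h
    exact h.congr fun n => by simp only [u]; ring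
  have hdecay : ∀ n : ℕ, S (e1Z d n) ≤ S 0 * Real.exp (-(l * n)) := fun n => by
    have hln : l * n ≤ u n := by
      rcases n.eq_zero_or_pos with rfl | hn
      · simpa using hu0 0
      · exact (le_div_iff₀ (by exact_mod_cast hn)).mp (hsub.lim_le_div hbdd hn.ne')
    rw [← Real.exp_log (hpos (e1Z d n)), ← Real.exp_log (hpos 0), ← Real.exp_add]
    refine Real.exp_le_exp.mpr ?_
    simp only [u] at hln
    linarith
  have hub : ∀ t ∈ {t : ℝ | 0 ≤ t ∧ chi S (e1R d t) < ⊤}, t ≤ l := fun t ht => by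
    by_contra! hlt
    exact ht.2.ne (chi_eq_top_of_tendsto hd hpos hlim' hlt)
  have hmass : mass S = l := by
    refine le_antisymm (Real.sSup_le hub hl0) (le_of_forall_lt fun t ht => ?_)
    rcases lt_or_ge t 0 with htneg | htnn
    · exact htneg.trans_le (Real.sSup_nonneg fun t ht => ht.1)
    · obtain ⟨s, hts, hsl⟩ := exists_between ht
      have hs := chi_lt_top_of_le_exp hd (htnn.trans hts.le) hsl
        (rwG_le_exp h0 hD hd hsym hz hdecay) (hpos 0).le
      exact hts.trans_le (le_csSup ⟨l, hub⟩ ⟨htnn.trans hts.le, hs⟩)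
  rw [hmass]
  exact ⟨hl0, hlim'⟩

theorem tendsto_mass_rwG {D : (Fin d → ℤ) → ℝ} (hd : 0 < d) (h0 : ∀ x, 0 ≤ D x)
    (hD : HasSum D 1) (hsym : ZdSymmetric D)
    (hsupp : ∀ L : AddSubgroup (Fin d → ℤ), (∀ x, D x ≠ 0 → x ∈ L) → L = ⊤) :
    Tendsto (fun z => mass (rwG D z)) (𝓝[<] (1 : ℝ)) (𝓝 0) := by
  obtain ⟨x₀, hx₀, hx₀'⟩ : ∃ x, D x ≠ 0 ∧ x ⟨0, hd⟩ ≠ 0 := by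
    by_contra! h
    have htop := hsupp (Pi.evalAddMonoidHom (fun _ : Fin d => ℤ) ⟨0, hd⟩).ker fun x hx => h x hx
    have hmem : e1Z d 1 ∈ (Pi.evalAddMonoidHom (fun _ : Fin d => ℤ) ⟨0, hd⟩).ker :=
      htop ▸ AddSubgroup.mem_top _
    simp [AddMonoidHom.mem_ker, e1Z] at hmem
  have hxR : (x₀ ⟨0, hd⟩ : ℝ) ≠ 0 := by exact_mod_cast hx₀'
  refine tendsto_order.mpr ⟨fun a ha => Eventually.of_forall fun z =>
    ha.trans_le (Real.sSup_nonneg fun t ht => ht.1), fun a ha => ?_⟩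
  obtain ⟨ε, hε, hεa⟩ := exists_between ha
  set c := 1 + D x₀ * (Real.cosh (ε * x₀ ⟨0, hd⟩) - 1) with hc
  have hc1 : 1 < c := by
    have := mul_pos ((h0 x₀).lt_of_ne' hx₀)
      (sub_pos.mpr (Real.one_lt_cosh.mpr (mul_ne_zero hε.ne' hxR)))
    linarith
  have hcinv : c⁻¹ < 1 := inv_lt_one_of_one_lt₀ hc1
  have hcpos : 0 < c := zero_lt_one.trans hc1
  filter_upwards [Ioo_mem_nhdsLT hcinv] with z hz
  have hz' : z ∈ Set.Ioo (0 : ℝ) 1 := ⟨(inv_pos.mpr hcpos).trans hz.1, hz.2⟩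
  refine lt_of_le_of_lt (Real.sSup_le (fun t ht => ?_) hε.le) hεa
  by_contra! hlt
  refine ht.2.ne (chi_rwG_eq_top h0 hD hz' ?_)
  have hcosh : Real.cosh (ε * x₀ ⟨0, hd⟩) ≤ Real.cosh (t * x₀ ⟨0, hd⟩) := by
    rw [Real.cosh_le_cosh, abs_mul, abs_mul, abs_of_pos hε, abs_of_pos (hε.trans hlt)]
    exact mul_le_mul_of_nonneg_right hlt.le (abs_nonneg _)
  have hzc : 1 ≤ z * c := by
    rw [← inv_mul_cancel₀ hcpos.ne']
    exact mul_le_mul_of_nonneg_right hz.1.le hcpos.le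
  calc (1 : ℝ≥0∞) ≤ ENNReal.ofReal (z * c) := ENNReal.one_le_ofReal.mpr hzc
    _ = ENNReal.ofReal z * ENNReal.ofReal c := ENNReal.ofReal_mul hz'.1.le
    _ ≤ ENNReal.ofReal z * chi D (e1R d t) := by
        gcongr
        refine (ENNReal.ofReal_le_ofReal ?_).trans (le_chi_e1R hd h0 hD hsym x₀ t)
        have := mul_le_mul_of_nonneg_left hcosh (h0 x₀)
        linarith

theorem statement13 (d : ℕ) (hd : 1 ≤ d) (D : (Fin d → ℤ) → ℝ)
    (hD01 : ∀ x, 0 ≤ D x ∧ D x ≤ 1) (hDsym : ZdSymmetric D)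
    (hDsummable : Summable D) (hDprob : ∑' x, D x = 1)
    (hDsupp : ∀ L : AddSubgroup (Fin d → ℤ), (∀ x, D x ≠ 0 → x ∈ L) → L = ⊤)
    (hD2 : Summable fun x => enormZ x ^ 2 * D x) :
    (∀ z ∈ Set.Ioo (0 : ℝ) 1,
      0 ≤ mass (rwG D z) ∧
      Tendsto (fun n : ℕ => -Real.log (rwG D z (e1Z d n)) / n) atTop
        (𝓝 (mass (rwG D z)))) ∧
    Tendsto (fun z => mass (rwG D z)) (𝓝[<] (1 : ℝ)) (𝓝 0) := by
  have h0 : ∀ x, 0 ≤ D x := fun x => (hD01 x).1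
  have hD : HasSum D 1 := hDprob ▸ hDsummable.hasSum
  exact ⟨fun z hz => tendsto_neg_log_rwG_div hd h0 hD hDsym hDsupp hz,
    tendsto_mass_rwG hd h0 hD hDsym hDsupp⟩

end OZpaper
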